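/- arXiv:1608.05622 — 8 statements merged into one kernel-verified Lean document; each statement's English description precedes it below -/
import Mathlib

section
/- Let n ≥ 3, let A be a real symmetric n × n matrix (equivalently, a real normal matrix with real eigenvalues), let v ∈ ℝⁿ, and let L ∈ ℕ. Then the family {A^j v : 0 ≤ j ≤ L} is not a strictly scalable frame for ℝⁿ; that is, no single vector v can generate a strictly scalable frame for ℝⁿ under iterations of a real symmetric operator when n ≥ 3. -/
open scoped Matrix

/-- The standard inner product on `ℝⁿ`. -/
def rInner {n : ℕ} (f g : Fin n → ℝ) : ℝ := ∑ i, f i * g i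

/-- The squared norm on `ℝⁿ`. -/
def rNormSq {n : ℕ} (f : Fin n → ℝ) : ℝ := ∑ i, f i ^ 2

/-- A finite family of vectors in `ℝⁿ` is a tight frame:
`Σᵢ ⟨x, Fᵢ⟩² = A‖x‖²` for all `x`, for some constant `A > 0`. -/
def IsTightFrame {n : ℕ} {ι : Type*} [Fintype ι] (F : ι → Fin n → ℝ) : Prop :=
  ∃ A : ℝ, 0 < A ∧ ∀ x : Fin n → ℝ, ∑ i, rInner x (F i) ^ 2 = A * rNormSq x

/-- A family of vectors in `ℝⁿ` is a strictly scalable frame: some strictly positive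
rescaling of it is a tight frame. -/
def IsStrictlyScalableFrame {n : ℕ} {ι : Type*} [Fintype ι] (F : ι → Fin n → ℝ) : Prop :=
  ∃ w : ι → ℝ, (∀ i, 0 < w i) ∧ IsTightFrame (fun i => w i • F i)

theorem rInner_eq_dotProduct {n : ℕ} (f g : Fin n → ℝ) : rInner f g = f ⬝ᵥ g := rfl

theorem rNormSq_eq_dotProduct {n : ℕ} (f : Fin n → ℝ) : rNormSq f = f ⬝ᵥ f := by
  simp only [rNormSq, dotProduct, pow_two]

/-- The polarization of the tight frame identity. -/
theorem sum_dotProduct_mul_dotProduct_of_tight {n : ℕ} {ι : Type*} [Fintype ι]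
    {F : ι → Fin n → ℝ} {c : ℝ}
    (hF : ∀ x : Fin n → ℝ, ∑ i, rInner x (F i) ^ 2 = c * rNormSq x) (x y : Fin n → ℝ) :
    ∑ i, (x ⬝ᵥ F i) * (y ⬝ᵥ F i) = c * (x ⬝ᵥ y) := by
  have hx := hF x
  have hy := hF y
  have hxy := hF (x + y)
  simp only [rInner_eq_dotProduct, rNormSq_eq_dotProduct, add_dotProduct, dotProduct_add,
    add_sq, Finset.sum_add_distrib, dotProduct_comm y x, mul_assoc] at hx hy hxy
  rw [← Finset.mul_sum] at hxy
  linarith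

theorem dotProduct_pow_mulVec_of_eigenvector {n : ℕ} {A : Matrix (Fin n) (Fin n) ℝ}
    (hA : A.IsSymm) {u : Fin n → ℝ} {μ : ℝ} (hu : A *ᵥ u = μ • u) (v : Fin n → ℝ) (j : ℕ) :
    u ⬝ᵥ ((A ^ j) *ᵥ v) = μ ^ j * (u ⬝ᵥ v) := by
  induction j with
  | zero => simp
  | succ j ih =>
    rw [pow_succ', ← Matrix.mulVec_mulVec, Matrix.dotProduct_mulVec, ← Matrix.mulVec_transpose,
      hA.eq, hu, smul_dotProduct, ih, smul_eq_mul, pow_succ']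
    ring

/-- Among three real numbers, two have a nonnegative product. -/
theorem exists_ne_mul_nonneg {ι : Type*} {a b c : ι} (hab : a ≠ b) (hac : a ≠ c) (hbc : b ≠ c)
    (μ : ι → ℝ) : ∃ k l, k ≠ l ∧ 0 ≤ μ k * μ l := by
  by_contra! h
  nlinarith [mul_pos_of_neg_of_neg (h a b hab) (h a c hac), h b c hbc, sq_nonneg (μ a)]

/-- For `n ≥ 3`, no real symmetric `n × n` matrix `A` can generate a strictly scalable
frame `{A^j v : 0 ≤ j ≤ L}` for `ℝⁿ` from a single vector `v`. -/
theorem symmetric_no_strictly_scalable_single_generator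
    {n : ℕ} (hn : 3 ≤ n) (A : Matrix (Fin n) (Fin n) ℝ) (hA : A.IsSymm)
    (v : Fin n → ℝ) (L : ℕ) :
    ¬ IsStrictlyScalableFrame (fun j : Fin (L + 1) => (A ^ (j : ℕ)) *ᵥ v) := by
  rintro ⟨w, hw, c, hc, hF⟩
  have hH : A.IsHermitian := by
    rw [Matrix.IsHermitian, Matrix.conjTranspose_eq_transpose_of_trivial, hA.eq]
  set u : Fin n → Fin n → ℝ := fun k => (hH.eigenvectorBasis k).ofLp
  set μ := hH.eigenvalues
  have hu (k) : A *ᵥ u k = μ k • u k := hH.mulVec_eigenvectorBasis k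
  have hon (k l) : u k ⬝ᵥ u l = if k = l then 1 else 0 := by
    have h := orthonormal_iff_ite.mp hH.eigenvectorBasis.orthonormal k l
    rw [EuclideanSpace.inner_eq_star_dotProduct] at h
    simpa [u, dotProduct_comm] using h
  have key (k l) : (u k ⬝ᵥ v) * (u l ⬝ᵥ v) * ∑ j : Fin (L + 1), w j ^ 2 * (μ k * μ l) ^ (j : ℕ)
      = c * if k = l then 1 else 0 := by
    rw [← hon, ← sum_dotProduct_mul_dotProduct_of_tight hF, Finset.mul_sum]
    refine Finset.sum_congr rfl fun j _ => ?_
    simp only [dotProduct_smul, dotProduct_pow_mulVec_of_eigenvector hA (hu _), smul_eq_mul]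
    ring
  have hv (k) : u k ⬝ᵥ v ≠ 0 := by
    intro h
    have := key k k
    simp [h, hc.ne] at this
  obtain ⟨k, l, hkl, hμ⟩ := exists_ne_mul_nonneg (a := (⟨0, by omega⟩ : Fin n))
    (b := ⟨1, by omega⟩) (c := ⟨2, by omega⟩) (by simp) (by simp) (by simp) μ
  have hpos : 0 < ∑ j : Fin (L + 1), w j ^ 2 * (μ k * μ l) ^ (j : ℕ) :=
    Finset.sum_pos' (fun j _ => by positivity)
      ⟨0, Finset.mem_univ _, by simpa using pow_pos (hw 0) 2⟩
  have h := key k l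
  rw [if_neg hkl, mul_zero] at h
  exact mul_ne_zero (mul_ne_zero (hv k) (hv l)) hpos.ne' h
end

section
/- Let a, d ∈ ℝ with a ≠ −d, let ε ∈ {+1, −1}, and define b = (ε/(a+d)) · sqrt( (a²(a+d)² + (a+d)² + a²) / (1 + (a+d)²) ) and c = −ε · a(ad + a² + 1) · sqrt( (1 + (a+d)²) / ((a+d)² + a²(a+d)² + a²) ). Then the family F = {e₁, A e₁, A² e₁} = {(1, 0)ᵀ, (a, b)ᵀ, (a² + bc, ab + bd)ᵀ}, where A = [[a, c], [b, d]], is a tight frame for ℝ². -/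
open scoped Matrix

/-- For `a ≠ -d`, `ε = ±1`, and `b, c` given by the stated formulas, the operator
`A = [[a, c], [b, d]]` generates the tight frame `{e₁, A e₁, A² e₁}` for `ℝ²`. -/
theorem tight_F2
    (a d ε b c : ℝ) (had : a ≠ -d) (hε : ε = 1 ∨ ε = -1)
    (hb : b = (ε / (a + d)) *
      Real.sqrt ((a ^ 2 * (a + d) ^ 2 + (a + d) ^ 2 + a ^ 2) / (1 + (a + d) ^ 2)))
    (hc : c = -ε * (a * (a * d + a ^ 2 + 1)) *
      Real.sqrt ((1 + (a + d) ^ 2) / ((a + d) ^ 2 + a ^ 2 * (a + d) ^ 2 + a ^ 2))) :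
    IsTightFrame
      (fun j : Fin 3 => ((!![a, c; b, d]) ^ (j : ℕ)) *ᵥ ![1, 0]) := by
  have ht : a + d ≠ 0 := fun h => had (eq_neg_of_add_eq_zero_left h)
  have hε2 : ε ^ 2 = 1 := by rcases hε with rfl | rfl <;> norm_num
  obtain ⟨t, rfl⟩ : ∃ t, d = t - a := ⟨a + d, by ring⟩
  rw [add_sub_cancel] at hb hc ht
  have hN : 0 < a ^ 2 * t ^ 2 + t ^ 2 + a ^ 2 := by positivity
  have hT : 0 < 1 + t ^ 2 := by positivity
  have hinv : (1 + t ^ 2) / (t ^ 2 + a ^ 2 * t ^ 2 + a ^ 2) =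
      ((a ^ 2 * t ^ 2 + t ^ 2 + a ^ 2) / (1 + t ^ 2))⁻¹ := by
    rw [inv_div]; congr 1; ring
  rw [hinv, Real.sqrt_inv] at hc
  have hs : 0 < Real.sqrt ((a ^ 2 * t ^ 2 + t ^ 2 + a ^ 2) / (1 + t ^ 2)) :=
    Real.sqrt_pos.2 (by positivity)
  have hs2 := Real.sq_sqrt (div_pos hN hT).le
  set s := Real.sqrt ((a ^ 2 * t ^ 2 + t ^ 2 + a ^ 2) / (1 + t ^ 2))
  have hs0 := hs.ne'
  have hu : a ^ 2 + b * c = -a / t := by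
    rw [hb, hc]
    field_simp
    linear_combination (-(a * (a * (t - a) + a ^ 2 + 1))) * hε2
  have hb2 : b ^ 2 * (1 + t ^ 2) = 1 + a ^ 2 + (a / t) ^ 2 := by
    rw [hb, mul_pow, div_pow, hε2, hs2]
    field_simp
    ring
  refine ⟨1 + a ^ 2 + (a / t) ^ 2, by positivity, fun x => ?_⟩
  have hsq : (!![a, c; b, t - a] ^ 2) *ᵥ ![1, 0] = ![-a / t, b * t] := by
    rw [← hu]
    ext i
    fin_cases i <;> simp [pow_two, Matrix.mul_apply, Matrix.mulVec, dotProduct] <;> ring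
  have hone : !![a, c; b, t - a] *ᵥ ![1, 0] = ![a, b] := by
    ext i
    fin_cases i <;> simp
  simp only [Fin.sum_univ_three, Fin.val_zero, Fin.val_one, Fin.val_two, pow_zero, pow_one,
    Matrix.one_mulVec, hsq, hone, rInner, rNormSq, Fin.sum_univ_two, Matrix.cons_val_zero,
    Matrix.cons_val_one]
  have hcancel : a / t * t = a := div_mul_cancel₀ a ht
  linear_combination x 1 ^ 2 * hb2 - 2 * x 0 * x 1 * b * hcancel
end

section
/- Let a, b, c, d ∈ ℝ with a > 0 and abcd ≠ 0. Then the following are equivalent: (1) 0 < −(ac)/(bd) < 1; (2) the family of three vectors {(1, 0)ᵀ, (a, b)ᵀ, (c, d)ᵀ} is a strictly scalable frame for ℝ². -/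
open scoped Matrix

/-- The scalability condition in terms of the squared weights `p`, `q`, `r`. -/
theorem three_vectors_weight_identity {a b c d p q r : ℝ} (hoff : q * (a * b) + r * (c * d) = 0)
    (hdiag : p + q * a ^ 2 + r * c ^ 2 = q * b ^ 2 + r * d ^ 2) :
    p * (b * c * d) ^ 2 =
      q * ((b * c) ^ 2 - a * b * c * d) * ((b * d) ^ 2 + (a * c) * (b * d)) := by
  linear_combination (b * c * d) ^ 2 * hdiag + b ^ 2 * c * d * (d ^ 2 - c ^ 2) * hoff

theorem div_mem_unit_interval_iff {x y : ℝ} (hy : y ≠ 0) :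
    (0 < -x / y ∧ -x / y < 1) ↔ (x * y < 0 ∧ 0 < y ^ 2 + x * y) := by
  have hy2 : 0 < y ^ 2 := by positivity
  have h : -x / y = -(x * y) / y ^ 2 := by field_simp
  rw [h, div_lt_one hy2, lt_div_iff₀ hy2]
  constructor <;> rintro ⟨h₁, h₂⟩ <;> constructor <;> linarith

/-- For `a > 0` and `abcd ≠ 0`, the family `{(1,0)ᵀ, (a,b)ᵀ, (c,d)ᵀ}` is a strictly
scalable frame for `ℝ²` iff `0 < -(ac)/(bd) < 1`. -/
theorem strictly_scalable_three_vectors_iff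
    (a b c d : ℝ) (ha : 0 < a) (habcd : a * b * c * d ≠ 0) :
    (0 < -(a * c) / (b * d) ∧ -(a * c) / (b * d) < 1) ↔
      IsStrictlyScalableFrame ![![1, 0], ![a, b], ![c, d]] := by
  have hb : b ≠ 0 := by rintro rfl; simp at habcd
  have hc : c ≠ 0 := by rintro rfl; simp at habcd
  have hd : d ≠ 0 := by rintro rfl; simp at habcd
  have hbcd : 0 < (b * c * d) ^ 2 := by positivity
  have hcd : 0 < (c * d) ^ 2 := by positivity
  have hbc : 0 < (b * c) ^ 2 := by positivity
  rw [div_mem_unit_interval_iff (mul_ne_zero hb hd)]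
  constructor
  · rintro ⟨h₁, h₂⟩
    have hr : 0 < -(a * b * c * d) := by linarith
    have hid := three_vectors_weight_identity (a := a) (b := b) (c := c) (d := d)
      (p := (c * d) ^ 2 * (b ^ 2 - a ^ 2) + -(a * b * c * d) * (d ^ 2 - c ^ 2))
      (q := (c * d) ^ 2) (r := -(a * b * c * d)) (by ring) (by ring)
    have hp : 0 < (c * d) ^ 2 * (b ^ 2 - a ^ 2) + -(a * b * c * d) * (d ^ 2 - c ^ 2) := by
      refine pos_of_mul_pos_left ?_ hbcd.le
      rw [hid]
      exact mul_pos (mul_pos hcd (by linarith)) h₂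
    refine ⟨![√((c * d) ^ 2 * (b ^ 2 - a ^ 2) + -(a * b * c * d) * (d ^ 2 - c ^ 2)),
      √((c * d) ^ 2), √(-(a * b * c * d))], ?_,
      (c * d) ^ 2 * b ^ 2 + -(a * b * c * d) * d ^ 2, by positivity, fun x => ?_⟩
    · intro i
      fin_cases i
      exacts [Real.sqrt_pos.2 hp, Real.sqrt_pos.2 hcd, Real.sqrt_pos.2 hr]
    · have e₁ := Real.sq_sqrt hp.le
      have e₂ := Real.sq_sqrt hcd.le
      have e₃ := Real.sq_sqrt hr.le
      generalize √((c * d) ^ 2 * (b ^ 2 - a ^ 2) + -(a * b * c * d) * (d ^ 2 - c ^ 2)) = u at *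
      generalize √((c * d) ^ 2) = v at *
      generalize √(-(a * b * c * d)) = w at *
      simp only [rInner, rNormSq, Fin.sum_univ_two, Fin.sum_univ_three, Pi.smul_apply,
        smul_eq_mul, Matrix.cons_val]
      linear_combination (x 0) ^ 2 * e₁ + (x 0 * a + x 1 * b) ^ 2 * e₂ +
        (x 0 * c + x 1 * d) ^ 2 * e₃
  · rintro ⟨w, hw, A, -, h⟩
    have h₁₀ := h ![1, 0]
    have h₀₁ := h ![0, 1]
    have h₁₁ := h ![1, 1]
    simp only [rInner, rNormSq, Fin.sum_univ_two, Fin.sum_univ_three, Pi.smul_apply,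
      smul_eq_mul, Matrix.cons_val] at h₁₀ h₀₁ h₁₁
    have hp : 0 < w 0 ^ 2 := pow_pos (hw 0) 2
    have hq : 0 < w 1 ^ 2 := pow_pos (hw 1) 2
    have hr : 0 < w 2 ^ 2 := pow_pos (hw 2) 2
    have hoff : w 1 ^ 2 * (a * b) + w 2 ^ 2 * (c * d) = 0 := by
      linear_combination (h₁₁ - h₁₀ - h₀₁) / 2
    have hid := three_vectors_weight_identity (p := w 0 ^ 2) hoff
      (by linear_combination h₁₀ - h₀₁)
    have hneg : a * b * c * d < 0 := by
      have : w 1 ^ 2 * (a * b * c * d) = -(w 2 ^ 2 * (c * d) ^ 2) := by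
        linear_combination (c * d) * hoff
      have hpos := mul_pos hr hcd
      exact neg_of_mul_neg_right (by linarith) hq.le
    refine ⟨by linarith, ?_⟩
    have hfac : 0 < w 1 ^ 2 * ((b * c) ^ 2 - a * b * c * d) := mul_pos hq (by linarith)
    exact pos_of_mul_pos_right (hid ▸ mul_pos hp hbcd) hfac.le
end

section
/- Let a, b, c, d ∈ ℝ with a > 0, b ≠ 0, a + d ≠ 0, and 0 < −a(a² + bc)/(b²(a + d)) < 1, and let A = [[a, c], [b, d]]. Then the family F = {e₁, A e₁, A² e₁} = {(1, 0)ᵀ, (a, b)ᵀ, (a² + bc, ab + bd)ᵀ} is a strictly scalable frame for ℝ². -/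
open scoped Matrix

/-- Strictly positive weights on the rank-one terms `⟨x, F i⟩²` that turn their sum into a
multiple of `‖x‖²` make a family strictly scalable. -/
theorem isStrictlyScalableFrame_of_weights {n : ℕ} {ι : Type*} [Fintype ι] (F : ι → Fin n → ℝ)
    (W : ι → ℝ) (hW : ∀ i, 0 < W i) (A : ℝ) (hA : 0 < A)
    (h : ∀ x : Fin n → ℝ, ∑ i, W i * rInner x (F i) ^ 2 = A * rNormSq x) :
    IsStrictlyScalableFrame F := by
  refine ⟨fun i => √(W i), fun i => Real.sqrt_pos.2 (hW i), A, hA, fun x => ?_⟩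
  rw [← h x]
  refine Finset.sum_congr rfl fun i _ => ?_
  have hsmul : rInner x (√(W i) • F i) = √(W i) * rInner x (F i) := by
    simp only [rInner, Finset.mul_sum, Pi.smul_apply, smul_eq_mul]
    exact Finset.sum_congr rfl fun j _ => by ring
  rw [hsmul, mul_pow, Real.sq_sqrt (hW i).le]

/-- For `a > 0`, `b ≠ 0`, `a + d ≠ 0` and `0 < -a(a² + bc)/(b²(a + d)) < 1`, the operator
`A = [[a, c], [b, d]]` generates the strictly scalable frame `{e₁, A e₁, A² e₁}` for `ℝ²`. -/
theorem strictly_scalable_F2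
    (a b c d : ℝ) (ha : 0 < a) (hb : b ≠ 0) (had : a + d ≠ 0)
    (h0 : 0 < -(a * (a ^ 2 + b * c)) / (b ^ 2 * (a + d)))
    (h1 : -(a * (a ^ 2 + b * c)) / (b ^ 2 * (a + d)) < 1) :
    IsStrictlyScalableFrame
      (fun j : Fin 3 => ((!![a, c; b, d]) ^ (j : ℕ)) *ᵥ ![1, 0]) := by
  set t := -(a * (a ^ 2 + b * c)) / (b ^ 2 * (a + d)) with ht
  have hp : a * (a ^ 2 + b * c) = -(t * (b ^ 2 * (a + d))) := by
    rw [ht]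
    field_simp
  have hp' : a ^ 2 + b * c = -(t * (b ^ 2 * (a + d))) / a := by
    rw [← hp]
    field_simp
  have h1t : 0 < 1 - t := by linarith
  refine (isStrictlyScalableFrame_of_weights
    (fun j : Fin 3 => ((!![a, c; b, d]) ^ (j : ℕ)) *ᵥ ![1, 0])
    ![b ^ 2 * (a + d) ^ 2 * (1 - t) * (t * b ^ 2 / a + a), t * b ^ 2 * (a + d) ^ 2 / a, a]
    ?_ (b ^ 2 * (t * b ^ 2 * (a + d) ^ 2 / a) + a * b ^ 2 * (a + d) ^ 2) (by positivity) ?_)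
  · intro i
    fin_cases i
    · simp only [Fin.zero_eta, Matrix.cons_val_zero]
      positivity
    · simp only [Fin.mk_one, Matrix.cons_val_one, Matrix.cons_val_zero]
      positivity
    · simpa using ha
  · intro x
    have hsq : ((!![a, c; b, d]) ^ 2) *ᵥ ![1, 0]
        = ![-(t * (b ^ 2 * (a + d))) / a, b * (a + d)] := by
      rw [← hp']
      ext i
      fin_cases i <;> simp [sq, Matrix.mulVec, dotProduct, Fin.sum_univ_two] <;> ring
    have hone : (!![a, c; b, d]) *ᵥ ![1, 0] = ![a, b] := by
      ext i
      fin_cases i <;> simp [Matrix.mulVec, dotProduct, Fin.sum_univ_two]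
    simp only [Fin.sum_univ_three, Fin.val_zero, Fin.val_one, Fin.val_two, pow_zero, pow_one,
      Matrix.one_mulVec, hsq, hone, rInner, rNormSq, Fin.sum_univ_two, Matrix.cons_val_zero,
      Matrix.cons_val_one, Matrix.cons_val]
    clear_value t
    field_simp
    ring
end

section
/- Let a, b, c, d ∈ ℝ with abcd < 0. Then the family of four vectors {(1, 0)ᵀ, (0, 1)ᵀ, (a, b)ᵀ, (c, d)ᵀ} is a strictly scalable frame for ℝ². -/
open scoped Matrix

/-- Two real numbers of opposite signs are balanced by each other's absolute values. -/
theorem abs_mul_add_abs_mul_eq_zero_of_mul_neg {u v : ℝ} (h : u * v < 0) :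
    |v| * u + |u| * v = 0 := by
  rcases mul_neg_iff.mp h with ⟨hu, hv⟩ | ⟨hu, hv⟩
  · rw [abs_of_neg hv, abs_of_pos hu]; ring
  · rw [abs_of_pos hv, abs_of_neg hu]; ring

/-- If `abcd < 0`, then the family `{(1,0)ᵀ, (0,1)ᵀ, (a,b)ᵀ, (c,d)ᵀ}` is a strictly
scalable frame for `ℝ²`. -/
theorem strictly_scalable_four_vectors
    (a b c d : ℝ) (habcd : a * b * c * d < 0) :
    IsStrictlyScalableFrame ![![1, 0], ![0, 1], ![a, b], ![c, d]] := by
  have hne := habcd.ne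
  simp only [ne_eq, mul_eq_zero, not_or] at hne
  obtain ⟨⟨⟨ha, hb⟩, hc⟩, hd⟩ := hne
  have hp : 0 < |c * d| := by positivity
  have hq : 0 < |a * b| := by positivity
  have hpq : |c * d| * (a * b) + |a * b| * (c * d) = 0 :=
    abs_mul_add_abs_mul_eq_zero_of_mul_neg (by linarith)
  set p := |c * d|
  set q := |a * b|
  have h₁ : 0 < p * b ^ 2 + q * d ^ 2 := by positivity
  have h₂ : 0 < p * a ^ 2 + q * c ^ 2 := by positivity
  refine ⟨![√(p * b ^ 2 + q * d ^ 2), √(p * a ^ 2 + q * c ^ 2), √p, √q], ?_,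
    p * (a ^ 2 + b ^ 2) + q * (c ^ 2 + d ^ 2), by positivity, fun x => ?_⟩
  · intro i
    fin_cases i <;> simpa
  · have e₁ := Real.sq_sqrt h₁.le
    have e₂ := Real.sq_sqrt h₂.le
    have e₃ := Real.sq_sqrt hp.le
    have e₄ := Real.sq_sqrt hq.le
    simp only [rInner, rNormSq, Fin.sum_univ_four, Fin.sum_univ_two, Pi.smul_apply, smul_eq_mul,
      Matrix.cons_val]
    linear_combination x 0 ^ 2 * e₁ + x 1 ^ 2 * e₂ + (x 0 * a + x 1 * b) ^ 2 * e₃ +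
      (x 0 * c + x 1 * d) ^ 2 * e₄ + 2 * x 0 * x 1 * hpq
end

section
/- Let a, b ∈ ℝ with a + b² < 0, and let A = [[0, a], [1, b]]. Then the family F = {e₁, A e₁, A² e₁, A³ e₁} = {(1, 0)ᵀ, (0, 1)ᵀ, (a, b)ᵀ, (ab, a + b²)ᵀ} is a strictly scalable frame for ℝ². -/
open scoped Matrix

/-- If `a + b² < 0`, then the operator `A = [[0, a], [1, b]]` generates the strictly
scalable frame `{e₁, A e₁, A² e₁, A³ e₁}` for `ℝ²`. -/
theorem strictly_scalable_F3
    (a b : ℝ) (hab : a + b ^ 2 < 0) :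
    IsStrictlyScalableFrame
      (fun j : Fin 4 => ((!![0, a; 1, b]) ^ (j : ℕ)) *ᵥ ![1, 0]) := by
  have hc : 0 < -(a + b ^ 2) := by linarith
  have h0 : 0 < 1 + -(a + b ^ 2) * b ^ 2 + (a + b ^ 2) ^ 2 := by positivity
  have h1 : 0 < 1 + -(a + b ^ 2) * a ^ 2 + a ^ 2 * b ^ 2 := by positivity
  refine ⟨![√(1 + -(a + b ^ 2) * b ^ 2 + (a + b ^ 2) ^ 2),
    √(1 + -(a + b ^ 2) * a ^ 2 + a ^ 2 * b ^ 2), √(-(a + b ^ 2)), 1], ?_,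
    1 + -(a + b ^ 2) * b ^ 2 + (a + b ^ 2) ^ 2 + -(a + b ^ 2) * a ^ 2 + a ^ 2 * b ^ 2,
    by positivity, ?_⟩
  · intro i
    fin_cases i
    · exact Real.sqrt_pos.2 h0
    · exact Real.sqrt_pos.2 h1
    · exact Real.sqrt_pos.2 hc
    · exact one_pos
  · intro x
    have s0 := Real.sq_sqrt h0.le
    have s1 := Real.sq_sqrt h1.le
    have s2 := Real.sq_sqrt hc.le
    generalize √(1 + -(a + b ^ 2) * b ^ 2 + (a + b ^ 2) ^ 2) = u at *
    generalize √(1 + -(a + b ^ 2) * a ^ 2 + a ^ 2 * b ^ 2) = v at *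
    generalize √(-(a + b ^ 2)) = w at *
    simp [rInner, rNormSq, Fin.sum_univ_succ, pow_succ, Matrix.mul_apply, Matrix.one_apply]
    linear_combination x 0 ^ 2 * s0 + x 1 ^ 2 * s1 + (x 0 * a + x 1 * b) ^ 2 * s2
end

section
/- Let a, b, c, d ∈ ℝ with a > 0, b ≠ 0, a + d ≠ 0, and 0 < −a(a² + bc)/(b²(a + d)) < 1, and let A be the 3 × 3 real matrix with rows (0, 0, 0), (1, a, c), (0, b, d). Then the family F = {e₁, A e₁, A² e₁, A³ e₁} = {(1, 0, 0)ᵀ, (0, 1, 0)ᵀ, (0, a, b)ᵀ, (0, a² + bc, ab + bd)ᵀ} is a strictly scalable frame for ℝ³. -/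
open scoped Matrix

/-- Nonnegative scalings enter the frame operator through their squares, so it suffices to find
positive weights making the weighted sum of squared coefficients a multiple of the norm. -/
theorem isStrictlyScalableFrame_of_sum_eq {n : ℕ} {ι : Type*} [Fintype ι] {F : ι → Fin n → ℝ}
    (u : ι → ℝ) (hu : ∀ i, 0 < u i) {A : ℝ} (hA : 0 < A)
    (h : ∀ x : Fin n → ℝ, ∑ i, u i * rInner x (F i) ^ 2 = A * rNormSq x) :
    IsStrictlyScalableFrame F := by
  refine ⟨fun i => √(u i), fun i => Real.sqrt_pos.mpr (hu i), A, hA, fun x => ?_⟩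
  rw [← h x]
  refine Finset.sum_congr rfl fun i _ => ?_
  have hsmul : rInner x (√(u i) • F i) = √(u i) * rInner x (F i) := by
    simp only [rInner, Pi.smul_apply, smul_eq_mul, Finset.mul_sum]
    exact Finset.sum_congr rfl fun j _ => by ring
  rw [hsmul, mul_pow, Real.sq_sqrt (hu i).le]

/-- For `a > 0`, `b ≠ 0`, `a + d ≠ 0` and `0 < -a(a² + bc)/(b²(a + d)) < 1`, the 3×3
operator `A` with rows `(0,0,0), (1,a,c), (0,b,d)` generates the strictly scalable
frame `{e₁, A e₁, A² e₁, A³ e₁}` for `ℝ³`. -/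
theorem strictly_scalable_R3
    (a b c d : ℝ) (ha : 0 < a) (hb : b ≠ 0) (had : a + d ≠ 0)
    (h0 : 0 < -(a * (a ^ 2 + b * c)) / (b ^ 2 * (a + d)))
    (h1 : -(a * (a ^ 2 + b * c)) / (b ^ 2 * (a + d)) < 1) :
    IsStrictlyScalableFrame
      (fun j : Fin 4 => ((!![0, 0, 0; 1, a, c; 0, b, d]) ^ (j : ℕ)) *ᵥ ![1, 0, 0]) := by
  have hF : (fun j : Fin 4 => ((!![0, 0, 0; 1, a, c; 0, b, d]) ^ (j : ℕ)) *ᵥ ![1, 0, 0]) =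
      ![![1, 0, 0], ![0, 1, 0], ![0, a, b], ![0, a ^ 2 + b * c, b * (a + d)]] := by
    funext j i
    fin_cases j <;> fin_cases i <;>
      simp [pow_succ, Matrix.mulVec, dotProduct, Matrix.mul_apply, Fin.sum_univ_three] <;> ring
  rw [hF]
  obtain ⟨t, ht⟩ : ∃ t, t = -(a * (a ^ 2 + b * c)) / (b ^ 2 * (a + d)) := ⟨_, rfl⟩
  rw [← ht] at h0 h1
  have hp : a ^ 2 + b * c = -(t * b ^ 2 * (a + d)) / a := by
    rw [ht]
    field_simp
  rw [hp]
  generalize a + d = s at had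
  have hb2 : 0 < b ^ 2 := by positivity
  have hs2 : 0 < s ^ 2 := by positivity
  have h1t : 0 < 1 - t := sub_pos.mpr h1
  have hA : 0 < b ^ 2 * s ^ 2 * (a ^ 2 + t * b ^ 2) := by positivity
  have hu₁ : 0 < b ^ 2 * s ^ 2 * (1 - t) * (a ^ 2 + t * b ^ 2) := by positivity
  have hu₂ : 0 < t * b ^ 2 * s ^ 2 := by positivity
  refine isStrictlyScalableFrame_of_sum_eq
    ![b ^ 2 * s ^ 2 * (a ^ 2 + t * b ^ 2), b ^ 2 * s ^ 2 * (1 - t) * (a ^ 2 + t * b ^ 2),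
      t * b ^ 2 * s ^ 2, a ^ 2] ?_ hA fun x => ?_
  · intro i
    fin_cases i
    exacts [hA, hu₁, hu₂, by simpa using pow_pos ha 2]
  · simp [Fin.sum_univ_four, Fin.sum_univ_three, rInner, rNormSq]
    field_simp
    ring
end

section
/- Let n ≥ 3 and let a, b, c, d ∈ ℝ with a > 0, b ≠ 0, a + d ≠ 0, and 0 < −a(a² + bc)/(b²(a + d)) < 1. Let A be the n × n real matrix whose first row is zero, whose subdiagonal entries A_{j+1,j} equal 1 for j = 1, …, n − 2, whose last two columns have bottom 2×2 block [[a, c], [b, d]] in rows n − 1 and n (i.e., A_{n−1,n−1} = a, A_{n−1,n} = c, A_{n,n−1} = b, A_{n,n} = d), and all other entries zero. Then the family F = {A^j e₁ : 0 ≤ j ≤ n}, which consists of e₁, e₂, …, e_{n−1} together with the vectors a e_{n−1} + b e_n and (a² + bc) e_{n−1} + (ab + bd) e_n, is a strictly scalable frame for ℝⁿ. -/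
open scoped Matrix

theorem rInner_single_one {n : ℕ} (x : Fin n → ℝ) (k : Fin n) :
    rInner x (Pi.single k 1) = x k := by
  simp [rInner, Pi.single_apply]

theorem rInner_add {n : ℕ} (x f g : Fin n → ℝ) :
    rInner x (f + g) = rInner x f + rInner x g := by
  simp [rInner, mul_add, Finset.sum_add_distrib]

theorem rInner_smul {n : ℕ} (r : ℝ) (x f : Fin n → ℝ) :
    rInner x (r • f) = r * rInner x f := by
  simp only [rInner, Pi.smul_apply, smul_eq_mul, Finset.mul_sum]
  exact Finset.sum_congr rfl fun i _ => by ring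

/-- If `A` shifts the first `k` basis vectors, then its powers send the first one to the
following ones. -/
theorem pow_mulVec_single_zero_of_shift {m : ℕ} (A : Matrix (Fin (m + 1)) (Fin (m + 1)) ℝ) (k : ℕ)
    (hA : ∀ j (hj : j + 1 < m + 1), j < k →
      A *ᵥ Pi.single ⟨j, by omega⟩ 1 = Pi.single ⟨j + 1, hj⟩ 1)
    (j : ℕ) (hj : j < m + 1) (hjk : j ≤ k) :
    (A ^ j) *ᵥ Pi.single 0 1 = Pi.single ⟨j, hj⟩ 1 := by
  induction j with
  | zero => simp only [pow_zero, Matrix.one_mulVec, Fin.mk_zero]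
  | succ j ih =>
    rw [pow_succ', ← Matrix.mulVec_mulVec, ih (by omega) (by omega), hA j hj (by omega)]

/-- Positive weights `x`, `y`, `z` that make `(1, 0)`, `(a, b)`, `(p, b * s)` a Parseval frame of
the plane. -/
theorem exists_pos_weights_plane {a b p s : ℝ} (ha : 0 < a) (hb : b ≠ 0) (hs : s ≠ 0)
    (h0 : 0 < -(a * p) / (b ^ 2 * s)) (h1 : -(a * p) / (b ^ 2 * s) < 1) :
    ∃ x y z : ℝ, 0 < x ∧ 0 < y ∧ 0 < z ∧ x + y * a ^ 2 + z * p ^ 2 = 1 ∧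
      y * b ^ 2 + z * (b * s) ^ 2 = 1 ∧ y * (a * b) + z * (p * (b * s)) = 0 := by
  have hb2 : 0 < b ^ 2 := by positivity
  have hs2 : 0 < s ^ 2 := by positivity
  have hps : p * s < 0 := by
    have h : -(a * p) / (b ^ 2 * s) * (b ^ 2 * s ^ 2) = -(a * (p * s)) := by
      field_simp
    have : 0 < -(a * (p * s)) := h ▸ by positivity
    by_contra! hc
    nlinarith [mul_nonneg ha.le hc]
  obtain ⟨t, rfl⟩ : ∃ t, p = a * s - t := ⟨a * s - p, by ring⟩
  have hst : 0 < s * t := by nlinarith [mul_pos ha hs2]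
  have ht : t ≠ 0 := right_ne_zero_of_mul hst.ne'
  refine ⟨1 - -(a * (a * s - t)) / (b ^ 2 * s), -((a * s - t) * s) / (b ^ 2 * (s * t)),
    a / (b ^ 2 * (s * t)), by linarith, div_pos (by linarith) (by positivity),
    by positivity, ?_, ?_, ?_⟩
  all_goals
    field_simp
    ring

/-- For `n ≥ 3`, `a > 0`, `b ≠ 0`, `a + d ≠ 0` and `0 < -a(a² + bc)/(b²(a + d)) < 1`,
the `n × n` operator `A` (first row zero, ones on the subdiagonal in the first `n - 2`
columns, bottom-right block `[[a, c], [b, d]]`, zeros elsewhere — entries written here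
in 0-indexed form) generates the strictly scalable frame `{A^j e₁ : 0 ≤ j ≤ n}`
for `ℝⁿ`. -/
theorem strictly_scalable_Rn
    {n : ℕ} (hn : 3 ≤ n)
    (a b c d : ℝ) (ha : 0 < a) (hb : b ≠ 0) (had : a + d ≠ 0)
    (h0 : 0 < -(a * (a ^ 2 + b * c)) / (b ^ 2 * (a + d)))
    (h1 : -(a * (a ^ 2 + b * c)) / (b ^ 2 * (a + d)) < 1)
    (A : Matrix (Fin n) (Fin n) ℝ)
    (hA : ∀ i j : Fin n, A i j =
      if (i : ℕ) = (j : ℕ) + 1 ∧ (j : ℕ) ≤ n - 3 then 1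
      else if (i : ℕ) = n - 2 ∧ (j : ℕ) = n - 2 then a
      else if (i : ℕ) = n - 2 ∧ (j : ℕ) = n - 1 then c
      else if (i : ℕ) = n - 1 ∧ (j : ℕ) = n - 2 then b
      else if (i : ℕ) = n - 1 ∧ (j : ℕ) = n - 1 then d
      else 0) :
    IsStrictlyScalableFrame
      (fun j : Fin (n + 1) =>
        (A ^ (j : ℕ)) *ᵥ (fun i : Fin n => if (i : ℕ) = 0 then 1 else 0)) := by
  obtain ⟨m, rfl⟩ : ∃ m, n = m + 3 := ⟨n - 3, by omega⟩
  obtain ⟨x, y, z, hx, hy, hz, h11, h22, h12⟩ := exists_pos_weights_plane ha hb had h0 h1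
  obtain ⟨p, hp⟩ : ∃ p : Fin (m + 3), p = (Fin.last (m + 1)).castSucc := ⟨_, rfl⟩
  obtain ⟨q, hq⟩ : ∃ q : Fin (m + 3), q = Fin.last (m + 2) := ⟨_, rfl⟩
  have hq_val : (q : ℕ) = m + 2 := by rw [hq, Fin.val_last]
  have hstart : (fun i : Fin (m + 3) => if (i : ℕ) = 0 then (1 : ℝ) else 0) = Pi.single 0 1 := by
    ext i
    simp only [Pi.single_apply, Fin.ext_iff, Fin.val_zero]
  have hshift : ∀ j (hj : j + 1 < m + 2 + 1), j < m + 1 →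
      A *ᵥ Pi.single ⟨j, by omega⟩ 1 = Pi.single ⟨j + 1, hj⟩ 1 := by
    intro j hj hjm
    ext i
    simp only [Matrix.mulVec_single_one, Matrix.col_apply, hA, Pi.single_apply, Fin.ext_iff]
    split_ifs <;> first | (exfalso; omega) | simp
  have hAp : A *ᵥ Pi.single p 1 = a • Pi.single p 1 + b • Pi.single q 1 := by
    ext i
    simp only [Matrix.mulVec_single_one, Matrix.col_apply, hA, Pi.single_apply, Fin.ext_iff, hp, hq,
      Pi.add_apply, Pi.smul_apply, smul_eq_mul, Fin.val_castSucc, Fin.val_last]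
    split_ifs <;> first | (exfalso; omega) | simp
  have hAq : A *ᵥ Pi.single q 1 = c • Pi.single p 1 + d • Pi.single q 1 := by
    ext i
    simp only [Matrix.mulVec_single_one, Matrix.col_apply, hA, Pi.single_apply, Fin.ext_iff, hp, hq,
      Pi.add_apply, Pi.smul_apply, smul_eq_mul, Fin.val_castSucc, Fin.val_last]
    split_ifs <;> first | (exfalso; omega) | simp
  have hpow := pow_mulVec_single_zero_of_shift A (m + 1) hshift
  have hpow_p : (A ^ (m + 1)) *ᵥ Pi.single 0 1 = Pi.single p 1 :=
    hp ▸ hpow (m + 1) (by omega) le_rfl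
  have hpow_q : (A ^ (m + 2)) *ᵥ Pi.single 0 1 = a • Pi.single p 1 + b • Pi.single q 1 := by
    rw [pow_succ', ← Matrix.mulVec_mulVec, hpow_p, hAp]
  have hpow_last : (A ^ (m + 3)) *ᵥ Pi.single 0 1 =
      (a ^ 2 + b * c) • Pi.single p 1 + (b * (a + d)) • Pi.single q 1 := by
    rw [pow_succ', ← Matrix.mulVec_mulVec, hpow_q, Matrix.mulVec_add, Matrix.mulVec_smul,
      Matrix.mulVec_smul, hAp, hAq]
    module
  refine ⟨fun j => if (j : ℕ) = m + 1 then √x else if (j : ℕ) = m + 2 then √y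
    else if (j : ℕ) = m + 3 then √z else 1, fun j => ?_, 1, one_pos, fun v => ?_⟩
  · dsimp only
    split_ifs <;> positivity
  · have hinit (i : Fin (m + 1)) :
        rInner v ((A ^ (i : ℕ)) *ᵥ Pi.single 0 1) = v i.castSucc.castSucc := by
      rw [hpow i (by omega) (by omega), rInner_single_one]
      rfl
    have hne (i : Fin (m + 1)) :
        (i : ℕ) ≠ m + 1 ∧ (i : ℕ) ≠ m + 2 ∧ (i : ℕ) ≠ m + 3 := by omega
    rw [hstart, rNormSq]
    simp only [Fin.sum_univ_castSucc (n := m + 3), Fin.sum_univ_castSucc (n := m + 2),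
      Fin.sum_univ_castSucc (n := m + 1), Fin.val_castSucc, Fin.val_last, rInner_smul, hinit,
      hpow_p, hpow_q, hpow_last, rInner_add, rInner_single_one, (hne _).1, (hne _).2.1,
      (hne _).2.2, if_true, if_false, one_mul, one_pow, mul_pow, Real.sq_sqrt hx.le, ← hp, ← hq, hq_val,
      show m + 2 ≠ m + 1 by omega, show m + 3 ≠ m + 1 by omega, show m + 3 ≠ m + 2 by omega,
      Real.sq_sqrt hy.le, Real.sq_sqrt hz.le]
    linear_combination v p ^ 2 * h11 + v q ^ 2 * h22 + 2 * v p * v q * h12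
end
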